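/- Assume A and B. Then for every player i ∈ N and every ℓ ∈ L_0, the functional φ ↦ J_i^ℓ(φ) is continuous on Φ equipped with the product of weak topologies. -/

import Mathlib

open MeasureTheory ProbabilityTheory Filter Topology
open scoped ENNReal NNReal

namespace CSGame

/-- The joint action space of the players. -/
abbrev JA {n : ℕ} (A : Fin n → Type) : Type := (i : Fin n) → A i

/-- The data of a constrained discounted stochastic Markov game:
countable state space `X`, Borel action spaces `A i` with compact admissible
action sets `As i x`, transition probability `p`, initial distribution `η`,
discount factor `α`, cost/constraint functions `c i ℓ` (`ℓ = 0` is the cost,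
`ℓ ∈ L = {1,…,l}` are the constraints) and constraint bounds `κ i ℓ`. -/
structure GameData (n l : ℕ) (X : Type) (A : Fin n → Type)
    [MeasurableSpace X] [∀ i, MeasurableSpace (A i)] [∀ i, TopologicalSpace (A i)] where
  As : (i : Fin n) → X → Set (A i)
  p : X → JA A → Measure X
  η : Measure X
  α : ℝ
  c : Fin n → Fin (l + 1) → X → JA A → ℝ
  κ : Fin n → Fin (l + 1) → ℝ
  hAs_ne : ∀ i x, (As i x).Nonempty
  hAs_cpt : ∀ i x, IsCompact (As i x)
  hp : ∀ x a, IsProbabilityMeasure (p x a)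
  hpm : ∀ x y, Measurable fun a => p x a {y}
  hη : IsProbabilityMeasure η
  hα0 : 0 < α
  hα1 : α < 1
  hc : ∀ i ℓ x, Measurable (c i ℓ x)

variable {n l : ℕ}
variable {X : Type} [Countable X] [MeasurableSpace X] [DiscreteMeasurableSpace X]
  [TopologicalSpace X] [DiscreteTopology X] [BorelSpace X] [SecondCountableTopology X]
variable {A : Fin n → Type} [∀ i, MeasurableSpace (A i)] [∀ i, TopologicalSpace (A i)]
  [∀ i, PolishSpace (A i)] [∀ i, BorelSpace (A i)]

/-- The set of feasible action profiles in state `x` (the section of `𝕂` at `x`). -/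
def jointSet (G : GameData n l X A) (x : X) : Set (JA A) :=
  Set.univ.pi fun i => G.As i x

/-- Histories of the game: `Hist X AA t` records the initial state and `t`
state-action transitions, ending with the current state (this is `H^{t+1}`). -/
def Hist (X AA : Type) : ℕ → Type
  | 0 => X
  | t + 1 => Hist X AA t × AA × X

noncomputable instance histMS (X AA : Type) [MeasurableSpace X] [MeasurableSpace AA] :
    ∀ t, MeasurableSpace (Hist X AA t)
  | 0 => inferInstanceAs (MeasurableSpace X)
  | t + 1 =>
      letI := histMS X AA t
      inferInstanceAs (MeasurableSpace (Hist X AA t × AA × X))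

/-- The current (last) state of a history. -/
def lastState (X AA : Type) : ∀ t, Hist X AA t → X
  | 0, h => h
  | _ + 1, h => h.2.2

theorem measurable_lastState (X AA : Type) [MeasurableSpace X] [MeasurableSpace AA] :
    ∀ t, Measurable (lastState X AA t)
  | 0 => measurable_id
  | _ + 1 => measurable_snd.comp measurable_snd

variable (G : GameData n l X A)

/-- A (history dependent, randomised) strategy of player `i`: a sequence of
transition probabilities from histories to the action space of player `i`,
concentrated on the admissible action set at the current state. -/
structure Strategy (i : Fin n) where
  f : ∀ t, Hist X (JA A) t → ProbabilityMeasure (A i)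
  meas : ∀ t (s : Set (A i)), MeasurableSet s →
    Measurable fun h => (f t h : Measure (A i)) s
  supp : ∀ t h, f t h (G.As i (lastState X (JA A) t h)) = 1

/-- A stationary strategy of player `i`: a transition probability from states to
actions, concentrated on the admissible action set. -/
def Stat (i : Fin n) : Type :=
  {φ : X → ProbabilityMeasure (A i) // ∀ x, φ x (G.As i x) = 1}

noncomputable instance (i : Fin n) : TopologicalSpace (Stat G i) :=
  inferInstanceAs (TopologicalSpace
    {φ : X → ProbabilityMeasure (A i) // ∀ x, φ x (G.As i x) = 1})

/-- Multi-strategies: one strategy for each player. -/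
abbrev MultiStrategy : Type _ := ∀ i, Strategy G i

/-- Stationary multi-strategies (the set `Φ`). -/
abbrev StatProfile : Type _ := ∀ i, Stat G i

noncomputable instance : TopologicalSpace (StatProfile G) :=
  inferInstanceAs (TopologicalSpace (∀ i, Stat G i))

/-- The strategy induced by a stationary strategy. -/
noncomputable def ofStat (i : Fin n) (φ : Stat G i) : Strategy G i where
  f := fun t h => φ.1 (lastState X (JA A) t h)
  meas := fun t _s _hs =>
    (Measurable.of_discrete (f := fun x => (φ.1 x : Measure (A i)) _s)).comp
      (measurable_lastState X (JA A) t)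
  supp := fun t h => φ.2 _

/-- The multi-strategy induced by a stationary multi-strategy. -/
noncomputable def ofStatAll (φ : StatProfile G) : MultiStrategy G :=
  fun i => ofStat G i (φ i)

/-- `[π_{-i}, σ]` : player `i` deviates to `σ`, the others keep `π`. -/
noncomputable def combine (π : MultiStrategy G) (i : Fin n) (σ : Strategy G i) :
    MultiStrategy G :=
  Function.update π i σ

/-- `[φ_{-i}, γ]` for stationary profiles. -/
noncomputable def updStat (φ : StatProfile G) (i : Fin n) (γ : Stat G i) :
    StatProfile G :=
  Function.update φ i γ

/-- The joint (product) distribution of the players' actions after history `h`. -/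
noncomputable def jointLaw (π : MultiStrategy G) (t : ℕ) (h : Hist X (JA A) t) :
    Measure (JA A) :=
  Measure.pi fun i => ((π i).f t h : Measure (A i))

/-- The distribution of histories of length `t` under the multi-strategy `π`,
the transition probability `G.p` and the initial distribution `η'`
(the finite-dimensional marginals of the Ionescu–Tulcea measure `P^π_{η'}`). -/
noncomputable def histMeas (η' : Measure X) (π : MultiStrategy G) :
    ∀ t, Measure (Hist X (JA A) t)
  | 0 => η'
  | t + 1 =>
      (histMeas η' π t).bind fun h =>
        (jointLaw G π t h).bind fun a =>
          (G.p (lastState X (JA A) t h) a).map fun y =>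
            (show Hist X (JA A) (t + 1) from (h, a, y))

/-- Expected value of `f (x^{t+1}, a^{t+1})` under `π` (states enumerated from `1`
in the paper, from `0` here). -/
noncomputable def stageExp (η' : Measure X) (π : MultiStrategy G) (t : ℕ)
    (f : X → JA A → ℝ) : ℝ :=
  ∫ h, (∫ a, f (lastState X (JA A) t h) a ∂(jointLaw G π t h)) ∂(histMeas G η' π t)

/-- The expected discounted cost functional
`J(π) = (1-α) E^π_{η'} [∑_{t≥1} α^{t-1} f(x^t,a^t)]`. -/
noncomputable def Jfun (η' : Measure X) (f : X → JA A → ℝ) (π : MultiStrategy G) : ℝ :=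
  (1 - G.α) * ∑' t : ℕ, G.α ^ t * stageExp G η' π t f

/-- `J_i^ℓ(π)` of the paper. -/
noncomputable def J (i : Fin n) (ℓ : Fin (l + 1)) (π : MultiStrategy G) : ℝ :=
  Jfun G G.η (G.c i ℓ) π

/-- `π_i ∈ Δ_i(π_{-i})` : all constraints of player `i` are satisfied. -/
def Feas (i : Fin n) (π : MultiStrategy G) : Prop :=
  ∀ ℓ : Fin (l + 1), ℓ ≠ 0 → J G i ℓ π ≤ G.κ i ℓ

/-- Expectation of `w(x^{t+1})` (as an extended nonnegative real). -/
noncomputable def wStateExp (η' : Measure X) (π : MultiStrategy G) (t : ℕ)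
    (w : X → ℝ) : ℝ≥0∞ :=
  ∫⁻ h, ENNReal.ofReal (w (lastState X (JA A) t h)) ∂(histMeas G η' π t)

/-- Assumption A(i): continuity of the transition probability in the actions. -/
def AssumptionA1 : Prop :=
  ∀ x y, ContinuousOn (fun a => G.p x a {y}) (jointSet G x)

/-- Assumption A: continuity of the transition probability and of the
cost/constraint functions in the actions. -/
def AssumptionA : Prop :=
  AssumptionA1 G ∧ ∀ i ℓ x, ContinuousOn (G.c i ℓ x) (jointSet G x)

/-- Assumption B for the weight function `w`: `w ≥ 1` bounds all the costs on `𝕂`,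
the discounted tails `sup_π (1-α) E^π_η[∑_{t≥k} α^{t-1} w(x^t)]` vanish as `k → ∞`,
and for each stage `t` the family `{w(x^t)}` is uniformly integrable over all
multi-strategies. -/
def AssumptionB (w : X → ℝ) : Prop :=
  (∀ x, 1 ≤ w x) ∧
  (∀ i ℓ x a, a ∈ jointSet G x → |G.c i ℓ x a| ≤ w x) ∧
  Tendsto (fun k : ℕ => ⨆ π : MultiStrategy G,
      ENNReal.ofReal (1 - G.α) *
        ∑' t : ℕ, ENNReal.ofReal G.α ^ (k + t) * wStateExp G G.η π (k + t) w)
    atTop (𝓝 0) ∧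
  ∀ t : ℕ, Tendsto (fun k : ℕ => ⨆ π : MultiStrategy G,
      ∫⁻ h in {h | (k : ℝ) ≤ w (lastState X (JA A) t h)},
        ENNReal.ofReal (w (lastState X (JA A) t h)) ∂(histMeas G G.η π t))
    atTop (𝓝 0)

/-- Assumption C (Slater condition). -/
def AssumptionC : Prop :=
  ∀ (φ : StatProfile G) (i : Fin n), ∃ π : Strategy G i,
    ∀ ℓ : Fin (l + 1), ℓ ≠ 0 → J G i ℓ (combine G (ofStatAll G φ) i π) < G.κ i ℓ

/-- Assumption D: the initial distribution charges every state. -/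
def AssumptionD : Prop :=
  ∀ x : X, 0 < G.η {x}

/-- Assumption W (weighted-norm conditions of Wessels). -/
def AssumptionW (w : X → ℝ) : Prop :=
  (∀ x, 1 ≤ w x) ∧
  (∀ i ℓ x a, a ∈ jointSet G x → |G.c i ℓ x a| ≤ w x) ∧
  (∃ δ : ℝ, 1 ≤ δ ∧ δ * G.α < 1 ∧ ∀ x a, a ∈ jointSet G x →
      ∫⁻ y, ENNReal.ofReal (w y) ∂(G.p x a) ≤ ENNReal.ofReal (δ * w x)) ∧
  (∀ x, ContinuousOn (fun a => ∫⁻ y, ENNReal.ofReal (w y) ∂(G.p x a)) (jointSet G x)) ∧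
  (∫⁻ y, ENNReal.ofReal (w y) ∂G.η) < ⊤

/-- All cost and constraint functions are bounded. -/
def BoundedCosts : Prop :=
  ∀ i (ℓ : Fin (l + 1)), ∃ C : ℝ, ∀ x a, |G.c i ℓ x a| ≤ C

/-- A stationary multi-strategy `φ` is a Nash equilibrium of the constrained game:
it is feasible, and no player can lower his discounted cost by a unilateral
deviation to any (history dependent) strategy satisfying his constraints. -/
def IsNashStat (φ : StatProfile G) : Prop :=
  (∀ i, Feas G i (ofStatAll G φ)) ∧
  ∀ (i : Fin n) (σ : Strategy G i), Feas G i (combine G (ofStatAll G φ) i σ) →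
    J G i 0 (ofStatAll G φ) ≤ J G i 0 (combine G (ofStatAll G φ) i σ)

section Occupation

/-- A correlated strategy of the players. -/
structure CorrStrategy where
  f : ∀ t, Hist X (JA A) t → ProbabilityMeasure (JA A)
  meas : ∀ t (s : Set (JA A)), MeasurableSet s →
    Measurable fun h => (f t h : Measure (JA A)) s
  supp : ∀ t h, f t h (jointSet G (lastState X (JA A) t h)) = 1

/-- History distributions under a correlated strategy. -/
noncomputable def histMeasC (π : CorrStrategy G) : ∀ t, Measure (Hist X (JA A) t)
  | 0 => G.η
  | t + 1 =>
      (histMeasC π t).bind fun h =>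
        ((π.f t h : Measure (JA A))).bind fun a =>
          (G.p (lastState X (JA A) t h) a).map fun y =>
            (show Hist X (JA A) (t + 1) from (h, a, y))

/-- The occupation measure `ρ(K') = (1-α) E^π_η [∑_{t≥1} α^{t-1} 1_{K'}(x^t,a^t)]`
of a correlated strategy, as a measure on the state–action pairs. -/
noncomputable def occ (π : CorrStrategy G) : Measure (X × JA A) :=
  ENNReal.ofReal (1 - G.α) •
    Measure.sum fun t : ℕ => ENNReal.ofReal G.α ^ t •
      ((histMeasC G π t).bind fun h =>
        (π.f t h : Measure (JA A)).map fun a => (lastState X (JA A) t h, a))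

/-- The set `𝓜` of occupation measures of correlated strategies. -/
def OccSet : Set (ProbabilityMeasure (X × JA A)) :=
  {ρ | ∃ π : CorrStrategy G, (ρ : Measure (X × JA A)) = occ G π}

/-- Projection of a state–action pair onto the coordinates of player `i`. -/
def projAct (i : Fin n) : X × JA A → X × A i := fun q => (q.1, q.2 i)

/-- The set `𝓜_i` of statewise projections of occupation measures onto `𝕂_i`. -/
def MiSet (i : Fin n) : Set (ProbabilityMeasure (X × A i)) :=
  {μ | ∃ ρ ∈ OccSet G, (μ : Measure (X × A i)) = (ρ : Measure (X × JA A)).map (projAct i)}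

/-- The marginal `μ̂(x) = μ({x} × A_i(x))`. -/
noncomputable def marg (i : Fin n) (μ : ProbabilityMeasure (X × A i)) (x : X) : ℝ≥0∞ :=
  (μ : Measure (X × A i)) ({x} ×ˢ G.As i x)

/-- `μ = μ̂ φ` : `φ` disintegrates `μ`, i.e. `μ({x} × B) = φ(B|x) μ̂(x)`. -/
def Disint (i : Fin n) (μ : ProbabilityMeasure (X × A i)) (φ : Stat G i) : Prop :=
  ∀ x (B : Set (A i)), MeasurableSet B → B ⊆ G.As i x →
    (μ : Measure (X × A i)) ({x} ×ˢ B) = (φ.1 x B : ℝ≥0∞) * marg G i μ x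

/-- The occupation measure on state–action pairs of a multi-strategy. -/
noncomputable def occMulti (η' : Measure X) (π : MultiStrategy G) : Measure (X × JA A) :=
  ENNReal.ofReal (1 - G.α) •
    Measure.sum fun t : ℕ => ENNReal.ofReal G.α ^ t •
      ((histMeas G η' π t).bind fun h =>
        (jointLaw G π t h).map fun a => (lastState X (JA A) t h, a))

end Occupation

section COP

/-- The product distribution on action profiles in state `x` in which player `i`
plays the fixed action `ai` and every player `j ≠ i` plays `φ j`. -/
noncomputable def statJoint (φ : StatProfile G) (i : Fin n) (x : X) (ai : A i) :
    Measure (JA A) :=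
  Measure.pi fun j =>
    if h : j = i then Measure.dirac (cast (congrArg A h.symm) ai)
    else ((φ j).1 x : Measure (A j))

/-- `c_i^ℓ(x, [φ_{-i}(x), a_i])`. -/
noncomputable def cbar (φ : StatProfile G) (i : Fin n) (ℓ : Fin (l + 1)) (x : X)
    (ai : A i) : ℝ :=
  ∫ a, G.c i ℓ x a ∂(statJoint G φ i x ai)

/-- `p(y | x, [φ_{-i}(x), a_i])`. -/
noncomputable def pbar (φ : StatProfile G) (i : Fin n) (y x : X) (ai : A i) : ℝ≥0∞ :=
  ∫⁻ a, G.p x a {y} ∂(statJoint G φ i x ai)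

/-- Feasibility in the constrained optimisation problem `COP(φ_{-i})`:
`μ ∈ Pr(𝕂_i)` satisfies the constraint inequalities and the characteristic
equations of occupation measures. -/
def COPFeasible (φ : StatProfile G) (i : Fin n)
    (μ : ProbabilityMeasure (X × A i)) : Prop :=
  (μ : Measure (X × A i)) {q : X × A i | q.2 ∈ G.As i q.1} = 1 ∧
  (∀ ℓ : Fin (l + 1), ℓ ≠ 0 →
    ∫ q : X × A i, cbar G φ i ℓ q.1 q.2 ∂(μ : Measure (X × A i)) ≤ G.κ i ℓ) ∧
  ∀ x : X, (μ : Measure (X × A i)) ({x} ×ˢ G.As i x) =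
    ENNReal.ofReal (1 - G.α) * G.η {x} +
      ENNReal.ofReal G.α *
        ∫⁻ q : X × A i, pbar G φ i x q.1 q.2 ∂(μ : Measure (X × A i))

/-- The objective of `COP(φ_{-i})`. -/
noncomputable def COPObj (φ : StatProfile G) (i : Fin n)
    (μ : ProbabilityMeasure (X × A i)) : ℝ :=
  ∫ q : X × A i, cbar G φ i 0 q.1 q.2 ∂(μ : Measure (X × A i))

/-- The solution set `𝓞_i(φ_{-i})` of `COP(φ_{-i})`. -/
def COPSol (φ : StatProfile G) (i : Fin n) : Set (ProbabilityMeasure (X × A i)) :=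
  {μ | COPFeasible G φ i μ ∧
    ∀ ν, COPFeasible G φ i ν → COPObj G φ i μ ≤ COPObj G φ i ν}

end COP

section Perturbed

/-- `η̃` is a probability measure charging exactly the `η`-null states `X_0`. -/
def IsPerturb (ηt : Measure X) : Prop :=
  IsProbabilityMeasure ηt ∧ (∀ x, G.η {x} = 0 → 0 < ηt {x}) ∧
    ∀ x, G.η {x} ≠ 0 → ηt {x} = 0

/-- The perturbed initial distribution `η(m) = (1 - 1/m) η + (1/m) η̃`. -/
noncomputable def etam (ηt : Measure X) (m : ℕ) : Measure X :=
  ENNReal.ofReal (1 - 1 / (m : ℝ)) • G.η + ENNReal.ofReal (1 / (m : ℝ)) • ηt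

/-- The truncation `c_i^{ℓ,m}` of `c_i^ℓ` at the level `√m`. -/
noncomputable def ctrunc (i : Fin n) (ℓ : Fin (l + 1)) (m : ℕ) (x : X) (a : JA A) : ℝ :=
  max (-Real.sqrt m) (min (G.c i ℓ x a) (Real.sqrt m))

/-- `J_i^{ℓ,η(m)}`: discounted cost with truncated costs and perturbed initial
distribution. -/
noncomputable def Jm (ηt : Measure X) (m : ℕ) (i : Fin n) (ℓ : Fin (l + 1))
    (π : MultiStrategy G) : ℝ :=
  Jfun G (etam G ηt m) (ctrunc G i ℓ m) π

/-- The perturbed constraint bounds `κ_i^{ℓ,m} = (1 - 1/m) κ_i^ℓ + 1/√m`. -/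
noncomputable def kappam (i : Fin n) (ℓ : Fin (l + 1)) (m : ℕ) : ℝ :=
  (1 - 1 / (m : ℝ)) * G.κ i ℓ + 1 / Real.sqrt m

/-- `π_i ∈ Δ_i^m(π_{-i})` : the constraints of the `m`-CSG hold. -/
def FeasM (ηt : Measure X) (m : ℕ) (i : Fin n) (π : MultiStrategy G) : Prop :=
  ∀ ℓ : Fin (l + 1), ℓ ≠ 0 → Jm G ηt m i ℓ π ≤ kappam G i ℓ m

end Perturbed

end CSGame

open CSGame

namespace CSGame

variable {n l : ℕ}
variable {X : Type} [Countable X] [MeasurableSpace X] [DiscreteMeasurableSpace X]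
  [TopologicalSpace X] [DiscreteTopology X] [BorelSpace X] [SecondCountableTopology X]
variable {A : Fin n → Type} [∀ i, MeasurableSpace (A i)] [∀ i, TopologicalSpace (A i)]
  [∀ i, PolishSpace (A i)] [∀ i, BorelSpace (A i)]
variable (G : GameData n l X A)

/-! ### Generic semicontinuity facts -/

section Generic

variable {T : Type*} [TopologicalSpace T]

theorem cont_of_lsc_add (f g c : T → ℝ≥0∞) (hf : LowerSemicontinuous f)
    (hg : LowerSemicontinuous g) (hc : Continuous c) (hfin : ∀ x, g x ≠ ⊤)
    (h : ∀ x, f x + g x = c x) : Continuous f := by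
  rw [continuous_iff_lower_upperSemicontinuous]
  refine ⟨hf, fun x0 y hy => ?_⟩
  have h1 : c x0 < y + g x0 := by
    rw [← h]
    exact ENNReal.add_lt_add_right (hfin x0) hy
  obtain ⟨m, hm1, hm2⟩ := exists_between h1
  have h2 : LowerSemicontinuous fun x => y + g x :=
    LowerSemicontinuous.add lowerSemicontinuous_const hg
  filter_upwards [h2 x0 m hm2, hc.continuousAt.eventually (gt_mem_nhds hm1)] with x hx1 hx2
  by_contra hcon
  rw [not_lt] at hcon
  have h3 : y + g x ≤ c x := by
    rw [← h]
    gcongr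
  exact absurd (lt_of_le_of_lt h3 hx2) (not_lt.2 hx1.le)

theorem cont_of_approx (f : T → ℝ≥0∞) (g r : ℕ → T → ℝ≥0∞)
    (h : ∀ k x, f x = g k x + r k x) (hg : ∀ k, Continuous (g k))
    (s : ℕ → ℝ≥0∞) (hs : ∀ k x, r k x ≤ s k) (hs0 : Tendsto s atTop (𝓝 0)) :
    Continuous f := by
  rw [continuous_iff_lower_upperSemicontinuous]
  constructor
  · intro x0 y hy
    obtain ⟨c, hc1, hc2⟩ := exists_between hy
    obtain ⟨k, hk⟩ := (hs0.eventually (gt_mem_nhds (tsub_pos_of_lt hc1))).exists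
    have h1 : y < g k x0 := by
      by_contra hcon
      rw [not_lt] at hcon
      have : f x0 ≤ c := by
        rw [h k x0]
        calc g k x0 + r k x0 ≤ y + (c - y) := add_le_add hcon ((hs k x0).trans hk.le)
          _ = c := add_tsub_cancel_of_le hc1.le
      exact absurd hc2 (not_lt.2 this)
    filter_upwards [(hg k).continuousAt.eventually (lt_mem_nhds h1)] with x hx
    rw [h k x]
    exact lt_of_lt_of_le hx le_self_add
  · intro x0 y hy
    obtain ⟨c, hc1, hc2⟩ := exists_between hy
    obtain ⟨k, hk⟩ := (hs0.eventually (gt_mem_nhds (tsub_pos_of_lt hc2))).exists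
    have h1 : g k x0 < c := lt_of_le_of_lt (by rw [h k x0]; exact le_self_add) hc1
    filter_upwards [(hg k).continuousAt.eventually (gt_mem_nhds h1)] with x hx
    rw [h k x]
    calc g k x + r k x < c + (y - c) :=
          ENNReal.add_lt_add hx (lt_of_le_of_lt (hs k x) hk)
      _ = y := add_tsub_cancel_of_le hc2.le

variable {Y : Type*} [Countable Y] [MeasurableSpace Y] [DiscreteMeasurableSpace Y]

theorem lsc_lintegral (ν : T → Measure Y) (hν : ∀ y, Continuous fun φ => ν φ {y})
    (hfin : ∀ φ y, ν φ {y} ≠ ⊤)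
    (g : T → Y → ℝ≥0∞) (hg : ∀ y, Continuous fun φ => g φ y) (hgf : ∀ φ y, g φ y ≠ ⊤) :
    LowerSemicontinuous fun φ => ∫⁻ y, g φ y ∂(ν φ) := by
  simp_rw [lintegral_countable']
  refine lowerSemicontinuous_tsum fun y => Continuous.lowerSemicontinuous ?_
  refine continuous_iff_continuousAt.2 fun φ => ?_
  exact ENNReal.Tendsto.mul (hg y).continuousAt (Or.inr (hfin φ y))
    (hν y).continuousAt (Or.inr (hgf φ y))

theorem cont_singleton (ν : T → Measure Y) (m : ℝ≥0∞) (hm : m ≠ ⊤) (hu : ∀ φ, ν φ Set.univ = m)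
    (hν : ∀ y, LowerSemicontinuous fun φ => ν φ {y}) (y : Y) :
    Continuous fun φ => ν φ {y} := by
  have hset : ∀ s : Set Y, LowerSemicontinuous fun φ => ν φ s := by
    intro s
    have h1 : ∀ φ, ν φ s = ∑' z : s, ν φ {(z : Y)} := by
      intro φ
      have := (ν φ).tsum_indicator_apply_singleton s (MeasurableSet.of_discrete)
      rw [← this, ← tsum_subtype]
    simp_rw [h1]
    exact lowerSemicontinuous_tsum fun z => hν z
  refine cont_of_lsc_add _ (fun φ => ν φ {y}ᶜ) (fun _ => m) (hν y) (hset _) continuous_const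
    (fun φ => ?_) (fun φ => ?_)
  · exact ne_top_of_le_ne_top hm ((measure_mono (Set.subset_univ _)).trans (hu φ).le)
  · rw [← hu φ]
    exact measure_add_measure_compl MeasurableSet.of_discrete

theorem cont_lintegral_bdd (ν : T → Measure Y) [∀ φ, IsProbabilityMeasure (ν φ)]
    (hν : ∀ y, Continuous fun φ => ν φ {y})
    (g : Y → ℝ≥0∞) (K : ℝ≥0∞) (hK : K ≠ ⊤) (hg : ∀ y, g y ≤ K) :
    Continuous fun φ => ∫⁻ y, g y ∂(ν φ) := by
  have hfin : ∀ φ y, ν φ {y} ≠ ⊤ := fun φ y => measure_ne_top _ _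
  refine cont_of_lsc_add _ (fun φ => ∫⁻ y, (K - g y) ∂(ν φ)) (fun _ => K)
    (lsc_lintegral ν hν hfin (fun _ => g) (fun y => continuous_const)
      (fun _ y => ne_top_of_le_ne_top hK (hg y)))
    (lsc_lintegral ν hν hfin (fun _ y => K - g y) (fun y => continuous_const)
      (fun _ y => ne_top_of_le_ne_top hK tsub_le_self)) continuous_const ?_ ?_
  · intro φ
    refine ne_top_of_le_ne_top hK ?_
    calc ∫⁻ y, (K - g y) ∂(ν φ) ≤ ∫⁻ y, K ∂(ν φ) := lintegral_mono fun y => tsub_le_self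
      _ = K := by simp
  · intro φ
    rw [← lintegral_add_left Measurable.of_discrete]
    have : ∀ y, g y + (K - g y) = K := fun y => add_tsub_cancel_of_le (hg y)
    simp [this]

theorem cont_integral (ν : T → Measure Y)
    (hν : ∀ y, Continuous fun φ => ν φ {y}) (hfin : ∀ φ y, ν φ {y} ≠ ⊤)
    (w : Y → ℝ) (C : T → Y → ℝ) (hC : ∀ y, Continuous fun φ => C φ y)
    (hCw : ∀ φ y, |C φ y| ≤ w y)
    (hW : Continuous fun φ => ∫⁻ y, ENNReal.ofReal (w y) ∂(ν φ))
    (hWf : ∀ φ, ∫⁻ y, ENNReal.ofReal (w y) ∂(ν φ) ≠ ⊤) :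
    (∀ φ, Integrable (C φ) (ν φ)) ∧ Continuous fun φ => ∫ y, C φ y ∂(ν φ) := by
  have hw0 : ∀ φ : T, ∀ y, 0 ≤ w y := fun φ y => (abs_nonneg _).trans (hCw φ y)
  have hwI : ∀ φ, Integrable w (ν φ) := by
    intro φ
    refine ⟨(Measurable.of_discrete).aestronglyMeasurable, ?_⟩
    rw [hasFiniteIntegral_iff_ofReal (Eventually.of_forall (hw0 φ))]
    exact (hWf φ).lt_top
  have hCI : ∀ φ, Integrable (C φ) (ν φ) := fun φ =>
    (hwI φ).mono' (Measurable.of_discrete).aestronglyMeasurable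
      (Eventually.of_forall fun y => hCw φ y)
  refine ⟨hCI, ?_⟩
  have hp : ∀ φ y, 0 ≤ w y + C φ y := fun φ y => by linarith [abs_le.1 (hCw φ y)]
  have hq : ∀ φ y, 0 ≤ w y - C φ y := fun φ y => by linarith [abs_le.1 (hCw φ y)]
  have hsum : ∀ φ, ∫⁻ y, ENNReal.ofReal (w y + C φ y) ∂(ν φ)
      + ∫⁻ y, ENNReal.ofReal (w y - C φ y) ∂(ν φ)
      = ∫⁻ y, ENNReal.ofReal (w y) ∂(ν φ) + ∫⁻ y, ENNReal.ofReal (w y) ∂(ν φ) := by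
    intro φ
    rw [← lintegral_add_left Measurable.of_discrete, ← lintegral_add_left Measurable.of_discrete]
    refine lintegral_congr fun y => ?_
    rw [← ENNReal.ofReal_add (hp φ y) (hq φ y), ← ENNReal.ofReal_add (hw0 φ y) (hw0 φ y)]
    congr 1
    ring
  have hsf : ∀ φ, ∫⁻ y, ENNReal.ofReal (w y) ∂(ν φ) + ∫⁻ y, ENNReal.ofReal (w y) ∂(ν φ) ≠ ⊤ :=
    fun φ => ENNReal.add_ne_top.2 ⟨hWf φ, hWf φ⟩
  have hcont : Continuous fun φ => ∫⁻ y, ENNReal.ofReal (w y + C φ y) ∂(ν φ) := by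
    refine cont_of_lsc_add _ (fun φ => ∫⁻ y, ENNReal.ofReal (w y - C φ y) ∂(ν φ)) _
      (lsc_lintegral ν hν hfin _ (fun y => ?_) (fun _ _ => ENNReal.ofReal_ne_top))
      (lsc_lintegral ν hν hfin _ (fun y => ?_) (fun _ _ => ENNReal.ofReal_ne_top))
      (hW.add hW) (fun φ => ?_) hsum
    · exact ENNReal.continuous_ofReal.comp (continuous_const.add (hC y))
    · exact ENNReal.continuous_ofReal.comp (continuous_const.sub (hC y))
    · exact ne_top_of_le_ne_top (hsf φ) (by rw [← hsum φ]; exact le_add_self)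
  have hpf : ∀ φ, ∫⁻ y, ENNReal.ofReal (w y + C φ y) ∂(ν φ) ≠ ⊤ := fun φ =>
    ne_top_of_le_ne_top (hsf φ) (by rw [← hsum φ]; exact le_self_add)
  have heq : ∀ φ, ∫ y, C φ y ∂(ν φ) =
      (∫⁻ y, ENNReal.ofReal (w y + C φ y) ∂(ν φ)).toReal
      - (∫⁻ y, ENNReal.ofReal (w y) ∂(ν φ)).toReal := by
    intro φ
    rw [← integral_eq_lintegral_of_nonneg_ae (Eventually.of_forall (hp φ))
      (Measurable.of_discrete).aestronglyMeasurable,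
      ← integral_eq_lintegral_of_nonneg_ae (Eventually.of_forall (hw0 φ))
      (Measurable.of_discrete).aestronglyMeasurable, integral_add (hwI φ) (hCI φ)]
    ring
  simp_rw [heq]
  refine Continuous.sub ?_ ?_
  · exact continuous_iff_continuousAt.2 fun φ =>
      (ENNReal.continuousAt_toReal (hpf φ)).comp (f := fun φ => ∫⁻ y, ENNReal.ofReal (w y + C φ y) ∂(ν φ)) hcont.continuousAt
  · exact continuous_iff_continuousAt.2 fun φ =>
      (ENNReal.continuousAt_toReal (hWf φ)).comp (f := fun φ => ∫⁻ y, ENNReal.ofReal (w y) ∂(ν φ)) hW.continuousAt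

end Generic

/-! ### The action law and the state law under a stationary profile -/

/-- The law of the joint action in state `x`. -/
noncomputable def actLaw (φ : StatProfile G) (x : X) : ProbabilityMeasure (JA A) :=
  ProbabilityMeasure.pi fun i => (φ i).1 x

theorem jointLaw_ofStatAll (φ : StatProfile G) (t : ℕ) (h : Hist X (JA A) t) :
    jointLaw G (ofStatAll G φ) t h = (actLaw G φ (lastState X (JA A) t h) : Measure (JA A)) := rfl

theorem continuous_actLaw (x : X) : Continuous fun φ : StatProfile G => actLaw G φ x := by
  refine ProbabilityMeasure.continuous_pi.comp (continuous_pi fun i => ?_)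
  have h1 : Continuous fun φ : StatProfile G => φ i := continuous_apply i
  have h2 : Continuous fun ψ : Stat G i => ψ.1 := continuous_subtype_val
  exact (continuous_apply x).comp (h2.comp h1)

theorem isCompact_jointSet (x : X) : IsCompact (jointSet G x) :=
  isCompact_univ_pi fun i => G.hAs_cpt i x

theorem actLaw_ae (φ : StatProfile G) (x : X) :
    ∀ᵐ a ∂(actLaw G φ x : Measure (JA A)), a ∈ jointSet G x := by
  have hm : MeasurableSet (jointSet G x) := (isCompact_jointSet G x).isClosed.measurableSet
  have h1 : (actLaw G φ x) (jointSet G x) = 1 := by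
    unfold actLaw jointSet
    rw [ProbabilityMeasure.pi_pi]
    exact Finset.prod_eq_one fun i _ => (φ i).2 x
  have h2 : (actLaw G φ x : Measure (JA A)) (jointSet G x) = 1 := by
    rw [← ProbabilityMeasure.ennreal_coeFn_eq_coeFn_toMeasure, h1, ENNReal.coe_one]
  exact (mem_ae_iff_prob_eq_one hm).2 h2

theorem continuous_actLaw_integral (x : X) (f : JA A → ℝ) (hf : ContinuousOn f (jointSet G x)) :
    Continuous fun φ : StatProfile G => ∫ a, f a ∂(actLaw G φ x : Measure (JA A)) := by
  have hK := isCompact_jointSet G x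
  haveI : CompactSpace (jointSet G x) := isCompact_iff_compactSpace.1 hK
  let f0 : BoundedContinuousFunction (jointSet G x) ℝ :=
    BoundedContinuousFunction.mkOfCompact ⟨(jointSet G x).domRestrict f, hf.domRestrict⟩
  letI : ∀ i, MetricSpace (A i) := fun i => TopologicalSpace.metrizableSpaceMetric (A i)
  obtain ⟨g, -, hg⟩ := BoundedContinuousFunction.exists_norm_eq_domRestrict_eq_of_closed f0 hK.isClosed
  have hfg : ∀ a ∈ jointSet G x, f a = g a := by
    intro a ha
    have := DFunLike.congr_fun hg ⟨a, ha⟩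
    exact this.symm
  have h1 : ∀ φ : StatProfile G, ∫ a, f a ∂(actLaw G φ x : Measure (JA A))
      = ∫ a, g a ∂(actLaw G φ x : Measure (JA A)) := fun φ =>
    integral_congr_ae ((actLaw_ae G φ x).mono hfg)
  simp_rw [h1]
  exact continuous_iff_continuousAt.2 fun φ =>
    (ProbabilityMeasure.tendsto_iff_forall_integral_tendsto.1
      (continuous_actLaw G x).continuousAt) g

/-- The transition kernel as a measurable function. -/
theorem measurable_p : Measurable fun q : X × JA A => G.p q.1 q.2 := by
  refine measurable_from_prod_countable_right fun x => ?_
  refine Measure.measurable_of_measurable_coe _ fun s _ => ?_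
  have h1 : ∀ a, G.p x a s = ∑' z : s, G.p x a {(z : X)} := by
    intro a
    have := (G.p x a).tsum_indicator_apply_singleton s (MeasurableSet.of_discrete)
    rw [← this, ← tsum_subtype]
  simp_rw [h1]
  exact Measurable.ennreal_tsum fun z => G.hpm x z

/-- One-step transition law of histories. -/
theorem measurable_step (φ : StatProfile G) (t : ℕ) :
    (∀ h : Hist X (JA A) t, Measurable fun a : JA A =>
          (G.p (lastState X (JA A) t h) a).map fun y =>
            (show Hist X (JA A) (t + 1) from (h, a, y))) ∧
    Measurable fun h : Hist X (JA A) t =>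
        (jointLaw G (ofStatAll G φ) t h).bind fun a =>
          (G.p (lastState X (JA A) t h) a).map fun y =>
            (show Hist X (JA A) (t + 1) from (h, a, y)) := by
  let κ : Kernel (Hist X (JA A) t) (JA A) :=
    ⟨fun h => (actLaw G φ (lastState X (JA A) t h) : Measure (JA A)),
      (Measurable.of_discrete (f := fun x => (actLaw G φ x : Measure (JA A)))).comp
        (measurable_lastState X (JA A) t)⟩
  haveI : IsMarkovKernel κ := ⟨fun h => inferInstanceAs (IsProbabilityMeasure (actLaw G φ _ : Measure (JA A)))⟩
  let P : Kernel (Hist X (JA A) t × JA A) X :=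
    ⟨fun q => G.p (lastState X (JA A) t q.1) q.2, (measurable_p G).comp
      (((measurable_lastState X (JA A) t).comp measurable_fst).prodMk measurable_snd)⟩
  haveI : IsMarkovKernel P := ⟨fun q => G.hp _ _⟩
  have hpair : ∀ (h : Hist X (JA A) t) (a : JA A), Measurable fun y : X =>
      (show Hist X (JA A) (t + 1) from (h, a, y)) := fun h a =>
    (measurable_const.prodMk (measurable_const.prodMk measurable_id) :
      Measurable fun y : X => ((h, a, y) : Hist X (JA A) t × JA A × X))
  have hsec : ∀ s : Set (Hist X (JA A) (t + 1)), MeasurableSet s →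
      Measurable fun q : Hist X (JA A) t × JA A =>
        (G.p (lastState X (JA A) t q.1) q.2).map (fun y =>
            (show Hist X (JA A) (t + 1) from (q.1, q.2, y))) s := by
    intro s hs
    have hass : Measurable fun r : (Hist X (JA A) t × JA A) × X =>
        (show Hist X (JA A) (t + 1) from (r.1.1, r.1.2, r.2)) :=
      ((measurable_fst.comp measurable_fst).prodMk
        ((measurable_snd.comp measurable_fst).prodMk measurable_snd) :
        Measurable fun r : (Hist X (JA A) t × JA A) × X =>
          ((r.1.1, r.1.2, r.2) : Hist X (JA A) t × JA A × X))
    have h1 := Kernel.measurable_kernel_prodMk_left (κ := P) (hass hs)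
    convert h1 using 2 with q
    rw [Measure.map_apply (hpair q.1 q.2) hs]
    rfl
  have hin : ∀ h : Hist X (JA A) t, Measurable fun a : JA A =>
          (G.p (lastState X (JA A) t h) a).map fun y =>
            (show Hist X (JA A) (t + 1) from (h, a, y)) := by
    intro h
    refine Measure.measurable_of_measurable_coe _ fun s hs => ?_
    exact (hsec s hs).comp (measurable_const.prodMk measurable_id)
  refine ⟨hin, Measure.measurable_of_measurable_coe _ fun s hs => ?_⟩
  have h2 := (hsec s hs).lintegral_kernel_prod_right' (κ := κ)
  convert h2 using 2 with h
  rw [Measure.bind_apply hs (hin h).aemeasurable]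
  rfl

/-- The law of the state at stage `t`. -/
noncomputable def stLaw (φ : StatProfile G) (t : ℕ) : Measure X :=
  (histMeas G G.η (ofStatAll G φ) t).map (lastState X (JA A) t)

theorem lintegral_stLaw (φ : StatProfile G) (t : ℕ) (g : X → ℝ≥0∞) :
    ∫⁻ x, g x ∂(stLaw G φ t)
      = ∫⁻ h, g (lastState X (JA A) t h) ∂(histMeas G G.η (ofStatAll G φ) t) :=
  lintegral_map Measurable.of_discrete (measurable_lastState X (JA A) t)

theorem stLaw_succ (φ : StatProfile G) (t : ℕ) (s : Set X) :
    stLaw G φ (t + 1) s = ∫⁻ x, (∫⁻ a, G.p x a s ∂(actLaw G φ x : Measure (JA A)))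
      ∂(stLaw G φ t) := by
  have hs : MeasurableSet s := MeasurableSet.of_discrete
  have hl := measurable_lastState X (JA A) (t + 1)
  rw [lintegral_stLaw]
  unfold stLaw
  rw [Measure.map_apply hl hs]
  change ((histMeas G G.η (ofStatAll G φ) t).bind _) _ = _
  rw [Measure.bind_apply (hl hs) (measurable_step G φ t).2.aemeasurable]
  refine lintegral_congr fun h => ?_
  rw [Measure.bind_apply (hl hs) ((measurable_step G φ t).1 h).aemeasurable, jointLaw_ofStatAll]
  refine lintegral_congr fun a => ?_
  rw [Measure.map_apply _ (hl hs)]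
  · rfl
  · exact (measurable_const.prodMk (measurable_const.prodMk measurable_id) :
      Measurable fun y : X => ((h, a, y) : Hist X (JA A) t × JA A × X))

theorem stLaw_prob (φ : StatProfile G) (t : ℕ) : IsProbabilityMeasure (stLaw G φ t) := by
  induction t with
  | zero =>
    haveI := G.hη
    exact Measure.isProbabilityMeasure_map (μ := G.η) (measurable_lastState X (JA A) 0).aemeasurable
  | succ t ih =>
    constructor
    rw [stLaw_succ]
    have h1 : ∀ x a, G.p x a Set.univ = 1 := fun x a => (G.hp x a).measure_univ
    simp [h1]

theorem continuous_trans (hA : AssumptionA1 G) (x y : X) :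
    Continuous fun φ : StatProfile G => ∫⁻ a, G.p x a {y} ∂(actLaw G φ x : Measure (JA A)) := by
  have hle : ∀ a, G.p x a {y} ≠ ⊤ := fun a => by
    haveI := G.hp x a
    exact measure_ne_top _ _
  have h1 : ContinuousOn (fun a => (G.p x a {y}).toReal) (jointSet G x) :=
    ENNReal.continuousOn_toReal.comp (hA x y) fun a _ => hle a
  have h2 := ENNReal.continuous_ofReal.comp (continuous_actLaw_integral G x _ h1)
  convert h2 using 2 with φ
  have hI : Integrable (fun a => (G.p x a {y}).toReal) (actLaw G φ x : Measure (JA A)) := by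
    refine Integrable.of_bound (C := 1) (G.hpm x y).ennreal_toReal.aestronglyMeasurable
      (Eventually.of_forall fun a => ?_)
    haveI := G.hp x a
    rw [Real.norm_of_nonneg ENNReal.toReal_nonneg]
    exact measureReal_le_one
  change _ = ENNReal.ofReal _
  rw [ofReal_integral_eq_lintegral_ofReal hI (Eventually.of_forall fun a => ENNReal.toReal_nonneg)]
  exact lintegral_congr fun a => (ENNReal.ofReal_toReal (hle a)).symm

theorem continuous_stLaw (hA : AssumptionA1 G) (t : ℕ) :
    ∀ y, Continuous fun φ : StatProfile G => stLaw G φ t {y} := by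
  induction t with
  | zero =>
    intro y
    let q : ℝ≥0∞ := (Measure.map (lastState X (JA A) 0) (show Measure (Hist X (JA A) 0) from G.η)) {y}
    exact (continuous_const : Continuous fun _ : StatProfile G => q)
  | succ t ih =>
    refine cont_singleton (fun φ : StatProfile G => stLaw G φ (t + 1)) 1 ENNReal.one_ne_top (fun φ : StatProfile G => (stLaw_prob G φ (t + 1)).measure_univ)
      fun y => ?_
    simp_rw [stLaw_succ]
    refine lsc_lintegral _ ih (fun φ z => ?_) _ (fun x => continuous_trans G hA x y) (fun φ x => ?_)
    · haveI := stLaw_prob G φ t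
      exact measure_ne_top _ _
    · refine ne_top_of_le_ne_top ENNReal.one_ne_top ?_
      calc ∫⁻ a, G.p x a {y} ∂(actLaw G φ x : Measure (JA A))
          ≤ ∫⁻ a, 1 ∂(actLaw G φ x : Measure (JA A)) := lintegral_mono fun a => by
            haveI := G.hp x a
            exact prob_le_one
        _ = 1 := by simp

/-- The (unnormalised) discounted occupation measure of states. -/
noncomputable def occSt (φ : StatProfile G) : Measure X :=
  Measure.sum fun t : ℕ => ENNReal.ofReal G.α ^ t • stLaw G φ t

theorem lintegral_occSt (φ : StatProfile G) (g : X → ℝ≥0∞) :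
    ∫⁻ x, g x ∂(occSt G φ) = ∑' t : ℕ, ENNReal.ofReal G.α ^ t * ∫⁻ x, g x ∂(stLaw G φ t) := by
  unfold occSt
  rw [lintegral_sum_measure]
  simp_rw [lintegral_smul_measure, smul_eq_mul]

theorem occSt_apply (φ : StatProfile G) (s : Set X) :
    occSt G φ s = ∑' t : ℕ, ENNReal.ofReal G.α ^ t * stLaw G φ t s := by
  unfold occSt
  rw [Measure.sum_apply _ MeasurableSet.of_discrete]
  rfl

theorem occSt_univ (φ : StatProfile G) :
    occSt G φ Set.univ = ∑' t : ℕ, ENNReal.ofReal G.α ^ t := by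
  rw [occSt_apply]
  refine tsum_congr fun t => ?_
  rw [(stLaw_prob G φ t).measure_univ, mul_one]

theorem geom_ne_top : ∑' t : ℕ, ENNReal.ofReal G.α ^ t ≠ ⊤ := by
  rw [ENNReal.tsum_geometric]
  refine ENNReal.inv_ne_top.2 (tsub_pos_of_lt ?_).ne'
  exact ENNReal.ofReal_lt_one.2 G.hα1

theorem occSt_ne_top (φ : StatProfile G) (s : Set X) : occSt G φ s ≠ ⊤ :=
  ne_top_of_le_ne_top (geom_ne_top G) ((measure_mono (Set.subset_univ _)).trans (occSt_univ G φ).le)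

theorem continuous_const_mul_pow (t : ℕ) (f : StatProfile G → ℝ≥0∞) (hf : Continuous f) :
    Continuous fun φ => ENNReal.ofReal G.α ^ t * f φ :=
  ENNReal.continuous_const_mul (ENNReal.pow_ne_top ENNReal.ofReal_ne_top) |>.comp hf

theorem continuous_occSt (hA : AssumptionA1 G) (y : X) :
    Continuous fun φ : StatProfile G => occSt G φ {y} := by
  refine cont_singleton _ _ (geom_ne_top G) (occSt_univ G) (fun y => ?_) y
  simp_rw [occSt_apply]
  exact lowerSemicontinuous_tsum fun t =>
    (continuous_const_mul_pow G t _ (continuous_stLaw G hA t y)).lowerSemicontinuous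

/-! ### Continuity of the weight functionals -/

theorem w_split (φ : StatProfile G) (w : X → ℝ) (t k : ℕ) :
    ∫⁻ x, ENNReal.ofReal (w x) ∂(stLaw G φ t)
    = ∫⁻ x, {x | (k : ℝ) ≤ w x}ᶜ.indicator (fun x => ENNReal.ofReal (w x)) x ∂(stLaw G φ t)
    + ∫⁻ h in {h | (k : ℝ) ≤ w (lastState X (JA A) t h)},
        ENNReal.ofReal (w (lastState X (JA A) t h)) ∂(histMeas G G.η (ofStatAll G φ) t) := by
  have hm : MeasurableSet {h | (k : ℝ) ≤ w (lastState X (JA A) t h)} :=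
    (measurable_lastState X (JA A) t) (MeasurableSet.of_discrete (s := {x | (k : ℝ) ≤ w x}))
  have h1 : ∫⁻ h in {h | (k : ℝ) ≤ w (lastState X (JA A) t h)},
        ENNReal.ofReal (w (lastState X (JA A) t h)) ∂(histMeas G G.η (ofStatAll G φ) t)
      = ∫⁻ x, {x | (k : ℝ) ≤ w x}.indicator (fun x => ENNReal.ofReal (w x)) x ∂(stLaw G φ t) := by
    rw [lintegral_stLaw, ← lintegral_indicator hm]
    rfl
  rw [h1, ← lintegral_add_left Measurable.of_discrete]
  refine lintegral_congr fun x => ?_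
  exact (congrFun (Set.indicator_compl_add_self {x | (k : ℝ) ≤ w x} (fun x => ENNReal.ofReal (w x))) x).symm

theorem trunc_le (w : X → ℝ) (k : ℕ) (x : X) :
    {x | (k : ℝ) ≤ w x}ᶜ.indicator (fun x => ENNReal.ofReal (w x)) x ≤ (k : ℝ≥0∞) := by
  by_cases hx : (k : ℝ) ≤ w x
  · rw [Set.indicator_of_notMem (by simpa using hx)]
    exact zero_le
  · rw [Set.indicator_of_mem (by simpa using hx), ← ENNReal.ofReal_natCast]
    exact ENNReal.ofReal_le_ofReal (not_le.1 hx).le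

theorem continuous_wStage (w : X → ℝ) (hA : AssumptionA1 G) (hB : AssumptionB G w) (t : ℕ) :
    (Continuous fun φ : StatProfile G => ∫⁻ x, ENNReal.ofReal (w x) ∂(stLaw G φ t)) ∧
    ∀ φ : StatProfile G, ∫⁻ x, ENNReal.ofReal (w x) ∂(stLaw G φ t) ≠ ⊤ := by
  obtain ⟨-, -, -, hB4⟩ := hB
  haveI : ∀ φ, IsProbabilityMeasure (stLaw G φ t) := fun φ => stLaw_prob G φ t
  have hsup : ∀ (k : ℕ) (φ : StatProfile G), _ ≤ _ := fun k φ =>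
    le_iSup (fun π : MultiStrategy G => ∫⁻ h in {h | (k : ℝ) ≤ w (lastState X (JA A) t h)},
        ENNReal.ofReal (w (lastState X (JA A) t h)) ∂(histMeas G G.η π t)) (ofStatAll G φ)
  constructor
  · exact cont_of_approx _ _ _ (fun k φ => w_split G φ w t k)
      (fun k => cont_lintegral_bdd _ (continuous_stLaw G hA t) _ (k : ℝ≥0∞)
        (ENNReal.natCast_ne_top k) (trunc_le w k)) _ hsup (hB4 t)
  · intro φ
    obtain ⟨k, hk⟩ := ((hB4 t).eventually (gt_mem_nhds zero_lt_one)).exists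
    rw [w_split G φ w t k]
    refine ENNReal.add_ne_top.2 ⟨ne_top_of_le_ne_top (ENNReal.natCast_ne_top k) ?_,
      ne_top_of_le_ne_top ENNReal.one_ne_top ((hsup k φ).trans hk.le)⟩
    calc _ ≤ ∫⁻ x, (k : ℝ≥0∞) ∂(stLaw G φ t) := lintegral_mono (trunc_le w k)
      _ = k := by simp

theorem continuous_wOcc (w : X → ℝ) (hA : AssumptionA1 G) (hB : AssumptionB G w) :
    (Continuous fun φ : StatProfile G => ∫⁻ x, ENNReal.ofReal (w x) ∂(occSt G φ)) ∧
    ∀ φ : StatProfile G, ∫⁻ x, ENNReal.ofReal (w x) ∂(occSt G φ) ≠ ⊤ := by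
  have hst := continuous_wStage G w hA hB
  obtain ⟨-, -, hB3, -⟩ := hB
  have ha0 : ENNReal.ofReal (1 - G.α) ≠ 0 := (ENNReal.ofReal_pos.2 (by linarith [G.hα1])).ne'
  have hat : ENNReal.ofReal (1 - G.α) ≠ ⊤ := ENNReal.ofReal_ne_top
  set a := ENNReal.ofReal (1 - G.α) with ha
  let F : StatProfile G → ℕ → ℝ≥0∞ := fun φ t =>
    ENNReal.ofReal G.α ^ t * ∫⁻ x, ENNReal.ofReal (w x) ∂(stLaw G φ t)
  have hsup : ∀ (k : ℕ) (φ : StatProfile G), a * ∑' t, F φ (k + t) ≤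
      ⨆ π : MultiStrategy G, a *
        ∑' t : ℕ, ENNReal.ofReal G.α ^ (k + t) * wStateExp G G.η π (k + t) w := by
    intro k φ
    have h1 := le_iSup (fun π : MultiStrategy G => a *
        ∑' t : ℕ, ENNReal.ofReal G.α ^ (k + t) * wStateExp G G.η π (k + t) w) (ofStatAll G φ)
    refine le_trans (le_of_eq ?_) h1
    congr 1
    refine tsum_congr fun t => ?_
    change _ * _ = _ * _
    rw [lintegral_stLaw]
    rfl
  have hsplit : ∀ k φ, a * ∫⁻ x, ENNReal.ofReal (w x) ∂(occSt G φ)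
      = a * ∑ t ∈ Finset.range k, F φ t + a * ∑' t, F φ (k + t) := by
    intro k φ
    rw [lintegral_occSt, ← mul_add]
    congr 1
    have h1 : Summable fun t => F φ (t + k) := ENNReal.summable
    rw [show (∑' t, F φ (k + t)) = ∑' t, F φ (t + k) from
      tsum_congr fun t => by rw [add_comm]]
    exact h1.sum_add_tsum_nat_add'.symm
  have hFf : ∀ φ t, F φ t ≠ ⊤ := fun φ t =>
    ENNReal.mul_ne_top (ENNReal.pow_ne_top ENNReal.ofReal_ne_top) ((hst t).2 φ)
  have hcont : Continuous fun φ : StatProfile G => a * ∫⁻ x, ENNReal.ofReal (w x) ∂(occSt G φ) :=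
    cont_of_approx _ _ _ hsplit (fun k => (ENNReal.continuous_const_mul hat).comp
      (continuous_finsetSum _ fun t _ => continuous_const_mul_pow G t _ (hst t).1)) _ hsup hB3
  have hfin : ∀ φ : StatProfile G, a * ∫⁻ x, ENNReal.ofReal (w x) ∂(occSt G φ) ≠ ⊤ := by
    intro φ
    obtain ⟨k, hk⟩ := (hB3.eventually (gt_mem_nhds zero_lt_one)).exists
    rw [hsplit k φ]
    exact ENNReal.add_ne_top.2 ⟨ENNReal.mul_ne_top hat (ENNReal.sum_ne_top.2 fun t _ => hFf φ t),
      ne_top_of_le_ne_top ENNReal.one_ne_top ((hsup k φ).trans hk.le)⟩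
  have hcancel : ∀ φ : StatProfile G, ∫⁻ x, ENNReal.ofReal (w x) ∂(occSt G φ)
      = a⁻¹ * (a * ∫⁻ x, ENNReal.ofReal (w x) ∂(occSt G φ)) := fun φ => by
    rw [← mul_assoc, ENNReal.inv_mul_cancel ha0 hat, one_mul]
  constructor
  · rw [funext hcancel]
    exact (ENNReal.continuous_const_mul (ENNReal.inv_ne_top.2 ha0)).comp hcont
  · intro φ
    rw [hcancel φ]
    exact ENNReal.mul_ne_top (ENNReal.inv_ne_top.2 ha0) (hfin φ)

/-- Lemma 7(b). -/
theorem stmt15 (w : X → ℝ) (hA : AssumptionA G) (hB : AssumptionB G w)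
    (i : Fin n) (ℓ : Fin (l + 1)) :
    Continuous fun φ : StatProfile G => J G i ℓ (ofStatAll G φ) := by
  let C : StatProfile G → X → ℝ := fun φ x => ∫ a, G.c i ℓ x a ∂(actLaw G φ x : Measure (JA A))
  have hC : ∀ x, Continuous fun φ => C φ x := fun x =>
    continuous_actLaw_integral G x _ (hA.2 i ℓ x)
  have hCw : ∀ φ x, |C φ x| ≤ w x := by
    intro φ x
    have h1 := norm_integral_le_of_norm_le_const (μ := (actLaw G φ x : Measure (JA A)))
      (f := G.c i ℓ x) (C := w x) ((actLaw_ae G φ x).mono fun a ha => hB.2.1 i ℓ x a ha)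
    simpa using h1
  obtain ⟨hW, hWf⟩ := continuous_wOcc G w hA.1 hB
  obtain ⟨hint, hcont⟩ := cont_integral (occSt G) (continuous_occSt G hA.1)
    (fun φ y => occSt_ne_top G φ _) w C hC hCw hW hWf
  have hJ : ∀ φ, J G i ℓ (ofStatAll G φ) = (1 - G.α) * ∫ x, C φ x ∂(occSt G φ) := by
    intro φ
    unfold J Jfun
    congr 1
    have h1 := hint φ
    unfold occSt at h1 ⊢
    rw [integral_sum_measure h1]
    refine tsum_congr fun t => ?_
    rw [integral_smul_measure, ENNReal.toReal_pow, ENNReal.toReal_ofReal G.hα0.le, smul_eq_mul]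
    congr 1
    unfold stLaw
    rw [integral_map (measurable_lastState X (JA A) t).aemeasurable
      (Measurable.of_discrete).aestronglyMeasurable]
    rfl
  simp_rw [hJ]
  exact continuous_const.mul hcont

end CSGame
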